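/- arXiv:2107.14477 — 3 statements merged into one kernel-verified Lean document; each statement's English description precedes it below -/
import Mathlib

section
/- For any integer d ≥ 0 and any a, b, c ∈ F, there exists a basis for the ℜ-module R_d(a,b,c) with respect to which C is represented by the lower bidiagonal matrix with (i,i)-entry θᵉᵢ = (c+d/2−i)(c+d/2−i+1) for 0 ≤ i ≤ d and all subdiagonal entries equal to 1. -/
open FreeAlgebra

noncomputable section

variable (F : Type) [Field F]

/-! ## The universal Racah algebra -/

/-- `α = [A,D] + AC - BA` in the free algebra on `A,B,C,D`. -/
def alphaFree : FreeAlgebra F (Fin 4) :=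
  ι F 0 * ι F 3 - ι F 3 * ι F 0 + ι F 0 * ι F 2 - ι F 1 * ι F 0

/-- `β = [B,D] + BA - CB` in the free algebra on `A,B,C,D`. -/
def betaFree : FreeAlgebra F (Fin 4) :=
  ι F 1 * ι F 3 - ι F 3 * ι F 1 + ι F 1 * ι F 0 - ι F 2 * ι F 1

/-- `γ = [C,D] + CB - AC` in the free algebra on `A,B,C,D`. -/
def gammaFree : FreeAlgebra F (Fin 4) :=
  ι F 2 * ι F 3 - ι F 3 * ι F 2 + ι F 2 * ι F 1 - ι F 0 * ι F 2

/-- The defining relations of the universal Racah algebra: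
`[A,B] = [B,C] = [C,A] = 2D` and `α`, `β`, `γ` commute with the generators. -/
inductive RacahRel : FreeAlgebra F (Fin 4) → FreeAlgebra F (Fin 4) → Prop
  | AB : RacahRel (ι F 0 * ι F 1 - ι F 1 * ι F 0) (2 * ι F 3)
  | BC : RacahRel (ι F 1 * ι F 2 - ι F 2 * ι F 1) (2 * ι F 3)
  | CA : RacahRel (ι F 2 * ι F 0 - ι F 0 * ι F 2) (2 * ι F 3)
  | alphaC (i : Fin 4) : RacahRel (alphaFree F * ι F i) (ι F i * alphaFree F)
  | betaC (i : Fin 4) : RacahRel (betaFree F * ι F i) (ι F i * betaFree F)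
  | gammaC (i : Fin 4) : RacahRel (gammaFree F * ι F i) (ι F i * gammaFree F)

/-- The universal Racah algebra `ℜ`. -/
abbrev RacahAlg := RingQuot (RacahRel F)

def rA : RacahAlg F := RingQuot.mkAlgHom F (RacahRel F) (ι F 0)
def rB : RacahAlg F := RingQuot.mkAlgHom F (RacahRel F) (ι F 1)
def rC : RacahAlg F := RingQuot.mkAlgHom F (RacahRel F) (ι F 2)
def rD : RacahAlg F := RingQuot.mkAlgHom F (RacahRel F) (ι F 3)
def rDelta : RacahAlg F := rA F + rB F + rC F
def rAlpha : RacahAlg F := RingQuot.mkAlgHom F (RacahRel F) (alphaFree F)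
def rBeta : RacahAlg F := RingQuot.mkAlgHom F (RacahRel F) (betaFree F)
def rGamma : RacahAlg F := RingQuot.mkAlgHom F (RacahRel F) (gammaFree F)

/-! ## The universal additive DAHA of type `(C₁∨, C₁)` -/

/-- The defining relations: `t₀ + t₁ + t₂ + t₃ = -1` and each `tᵢ²` is central. -/
inductive DAHARel : FreeAlgebra F (Fin 4) → FreeAlgebra F (Fin 4) → Prop
  | sum : DAHARel (ι F 0 + ι F 1 + ι F 2 + ι F 3) (-1)
  | central (i j : Fin 4) : DAHARel (ι F i * ι F i * ι F j) (ι F j * (ι F i * ι F i))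

/-- The universal additive DAHA `𝔥` of type `(C₁∨, C₁)`. -/
abbrev DAHAAlg := RingQuot (DAHARel F)

/-- The generators `t₀, t₁, t₂, t₃` of `𝔥`. -/
def tGen (i : Fin 4) : DAHAAlg F := RingQuot.mkAlgHom F (DAHARel F) (ι F i)

/-! ## Scalar restriction along `algebraMap`, actions as `F`-linear operators -/

/-- The `F`-vector space structure on a module over an `F`-algebra `A`. -/
def resF (A : Type) [Ring A] [Algebra F A] (W : Type) [AddCommGroup W] [Module A W] :
    Module F W := Module.compHom W (algebraMap F A)

theorem resF_tower (A : Type) [Ring A] [Algebra F A] (W : Type) [AddCommGroup W] [Module A W]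
    [instF : Module F W] (h : instF = resF F A W) : IsScalarTower F A W := by
  have key : ∀ (a : F) (u : W), a • u = algebraMap F A a • u := by
    intro a u; rw [h]; rfl
  exact ⟨fun a x w => by rw [Algebra.smul_def, mul_smul, key a (x • w)]⟩

/-- The action of `x : A` on an `A`-module `W` as an `F`-linear operator. -/
def opOf {A : Type} [Ring A] [Algebra F A] (x : A) (W : Type) [AddCommGroup W] [Module F W]
    [Module A W] [IsScalarTower F A W] : Module.End F W where
  toFun w := x • w
  map_add' u v := smul_add x u v
  map_smul' a w := by
    simp only [RingHom.id_apply]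
    rw [← algebraMap_smul A a w, ← mul_smul, ← Algebra.commutes, mul_smul, algebraMap_smul]

/-- `x : A` acts diagonalizably on the `A`-module `W`. -/
def ActsDiagOn {A : Type} [Ring A] [Algebra F A] (x : A) (W : Type) [AddCommGroup W]
    [Module A W] : Prop :=
  letI := resF F A W
  haveI := resF_tower F A W rfl
  (⨆ μ : F, Module.End.eigenspace (opOf F x W) μ) = ⊤

/-- `x : A` acts on the `A`-module `W` in a multiplicity-free way: every eigenvalue of the
action of `x` has algebraic multiplicity one. -/
def ActsMultFreeOn {A : Type} [Ring A] [Algebra F A] (x : A) (W : Type) [AddCommGroup W]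
    [Module A W] : Prop :=
  letI := resF F A W
  haveI := resF_tower F A W rfl
  ∀ μ : F, Module.End.HasEigenvalue (opOf F x W) μ →
    Module.finrank F (Module.End.maxGenEigenspace (opOf F x W) μ) = 1

/-- `x : A` acts on the `A`-module `W` as scalar multiplication by `μ : F`. -/
def actsAsScalar {A : Type} [Ring A] [Algebra F A] (x : A) (μ : F) (W : Type)
    [AddCommGroup W] [Module A W] : Prop :=
  letI := resF F A W
  ∀ u : W, x • u = μ • u

/-- The trace of the action of `x : A` on the `A`-module `W`. -/
def traceOf {A : Type} [Ring A] [Algebra F A] (x : A) (W : Type) [AddCommGroup W]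
    [Module A W] : F :=
  letI := resF F A W
  haveI := resF_tower F A W rfl
  LinearMap.trace F W (opOf F x W)

/-! ## Tridiagonal matrices, Leonard pairs and Leonard triples -/

/-- A square matrix is tridiagonal if each nonzero entry lies on the diagonal, the
superdiagonal, or the subdiagonal. -/
def IsTridiag {n : ℕ} (M : Matrix (Fin n) (Fin n) F) : Prop :=
  ∀ i j : Fin n, M i j ≠ 0 → (i : ℕ) = (j : ℕ) ∨ (i : ℕ) = (j : ℕ) + 1 ∨ (j : ℕ) = (i : ℕ) + 1

/-- A tridiagonal matrix is irreducible if every superdiagonal and subdiagonal entry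
is nonzero. -/
def IsIrrTridiag {n : ℕ} (M : Matrix (Fin n) (Fin n) F) : Prop :=
  IsTridiag F M ∧ ∀ i j : Fin n, ((i : ℕ) = (j : ℕ) + 1 ∨ (j : ℕ) = (i : ℕ) + 1) → M i j ≠ 0

/-- `x, y : A` act on the `A`-module `W` as a Leonard pair. -/
def ActsAsLeonardPairOn {A : Type} [Ring A] [Algebra F A] (x y : A) (W : Type)
    [AddCommGroup W] [Module A W] : Prop :=
  letI := resF F A W
  haveI := resF_tower F A W rfl
  (∃ (n : ℕ) (b : Module.Basis (Fin n) F W),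
      (LinearMap.toMatrix b b (opOf F x W)).IsDiag ∧
      IsIrrTridiag F (LinearMap.toMatrix b b (opOf F y W))) ∧
  (∃ (n : ℕ) (b : Module.Basis (Fin n) F W),
      (LinearMap.toMatrix b b (opOf F y W)).IsDiag ∧
      IsIrrTridiag F (LinearMap.toMatrix b b (opOf F x W)))

/-- `x, y, z : A` act on the `A`-module `W` as a Leonard triple. -/
def ActsAsLeonardTripleOn {A : Type} [Ring A] [Algebra F A] (x y z : A) (W : Type)
    [AddCommGroup W] [Module A W] : Prop :=
  letI := resF F A W
  haveI := resF_tower F A W rfl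
  (∃ (n : ℕ) (b : Module.Basis (Fin n) F W),
      (LinearMap.toMatrix b b (opOf F x W)).IsDiag ∧
      IsIrrTridiag F (LinearMap.toMatrix b b (opOf F y W)) ∧
      IsIrrTridiag F (LinearMap.toMatrix b b (opOf F z W))) ∧
  (∃ (n : ℕ) (b : Module.Basis (Fin n) F W),
      (LinearMap.toMatrix b b (opOf F y W)).IsDiag ∧
      IsIrrTridiag F (LinearMap.toMatrix b b (opOf F z W)) ∧
      IsIrrTridiag F (LinearMap.toMatrix b b (opOf F x W))) ∧
  (∃ (n : ℕ) (b : Module.Basis (Fin n) F W),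
      (LinearMap.toMatrix b b (opOf F z W)).IsDiag ∧
      IsIrrTridiag F (LinearMap.toMatrix b b (opOf F x W)) ∧
      IsIrrTridiag F (LinearMap.toMatrix b b (opOf F y W)))

/-! ## The irreducible `ℜ`-modules `R_d(a,b,c)` -/

/-- `θᵢ = (x + d/2 - i)(x + d/2 - i + 1)`. -/
def thP (x : F) (d i : ℕ) : F := (x + (d : F) / 2 - (i : F)) * (x + (d : F) / 2 - (i : F) + 1)

/-- `φᵢ = i(i-d-1)(a+b+c+d/2-i+2)(a+b-c+d/2-i+1)`. -/
def phP (a b c : F) (d i : ℕ) : F :=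
  (i : F) * ((i : F) - (d : F) - 1) * (a + b + c + (d : F) / 2 - (i : F) + 2) *
    (a + b - c + (d : F) / 2 - (i : F) + 1)

/-- `W` is (a copy of) the `(d+1)`-dimensional `ℜ`-module `R_d(a,b,c)`:  there is a basis
with respect to which `A` is lower bidiagonal with diagonal `θᵢ` and subdiagonal entries `1`,
`B` is upper bidiagonal with diagonal `θᵢ*` and superdiagonal entries `φᵢ`, and `δ` acts as
the prescribed scalar. -/
def IsRdModule (a b c : F) (d : ℕ) (W : Type) [AddCommGroup W] [Module (RacahAlg F) W] :
    Prop :=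
  letI := resF F (RacahAlg F) W
  ∃ v : Module.Basis (Fin (d + 1)) F W,
    (∀ i : Fin (d + 1), rA F • (v i : W) = thP F a d i • v i +
      (if h : (i : ℕ) + 1 < d + 1 then v ⟨(i : ℕ) + 1, h⟩ else 0)) ∧
    (∀ i : Fin (d + 1), rB F • (v i : W) = thP F b d i • v i +
      (if (i : ℕ) = 0 then 0 else
        phP F a b c d i • v ⟨(i : ℕ) - 1, lt_of_le_of_lt (Nat.sub_le _ _) i.isLt⟩)) ∧
    actsAsScalar F (rDelta F)
      ((d : F) / 2 * ((d : F) / 2 + 1) + a * (a + 1) + b * (b + 1) + c * (c + 1)) W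

/-! ## The homomorphism `ζ : ℜ → 𝔥` -/

/-- `ζ : ℜ → 𝔥` sends `A, B, C` to the prescribed elements of `𝔥`. -/
def IsZeta (ζ : RacahAlg F →ₐ[F] DAHAAlg F) : Prop :=
  ζ (rA F) = (1 / 4 : F) • ((tGen F 0 + tGen F 1 - 1) * (tGen F 0 + tGen F 1 + 1)) ∧
  ζ (rB F) = (1 / 4 : F) • ((tGen F 0 + tGen F 2 - 1) * (tGen F 0 + tGen F 2 + 1)) ∧
  ζ (rC F) = (1 / 4 : F) • ((tGen F 0 + tGen F 3 - 1) * (tGen F 0 + tGen F 3 + 1))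

/-- A `𝔥`-module considered as an `ℜ`-module via `ζ : ℜ → 𝔥`. -/
def racahModOfDaha (ζ : RacahAlg F →ₐ[F] DAHAAlg F) (V : Type) [AddCommGroup V]
    [Module (DAHAAlg F) V] : Module (RacahAlg F) V :=
  Module.compHom V ζ.toRingHom

/-! ## Composition factors -/

/-- The `i`-th factor of a composition series of submodules. -/
abbrev csFactor {R V : Type} [Ring R] [AddCommGroup V] [Module R V]
    (s : CompositionSeries (Submodule R V)) (i : Fin s.length) : Type :=
  (↥(s i.succ)) ⧸ Submodule.comap (s i.succ).subtype (s i.castSucc)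

/-! ## The `𝔥`-modules `E_d(a,b,c)` and `O_d(a,b,c)` -/

def sigP (a b c : F) (d : ℕ) : F := a + b + c - ((d : F) + 1) / 2
def tauP (a b c : F) (d : ℕ) : F := a + b - c - ((d : F) + 1) / 2
def lamP (a b c : F) (d : ℕ) : F := a - b - c - ((d : F) + 1) / 2
def muP (a b c : F) (d : ℕ) : F := c - a - b - ((d : F) + 1) / 2
def nuP (a b c : F) (d : ℕ) : F := b - a - c - ((d : F) + 1) / 2

/-- `W` is (a copy of) the `(d+1)`-dimensional `𝔥`-module `E_d(a,b,c)` (`d` odd):  there is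
a basis `v₀, …, v_d` (extended by zero to a sequence `w`) on which `t₀, t₁, t₂, t₃` act by the
prescribed formulas. -/
def IsEdModule (a b c : F) (d : ℕ) (W : Type) [AddCommGroup W] [Module (DAHAAlg F) W] :
    Prop :=
  letI := resF F (DAHAAlg F) W
  ∃ (v : Module.Basis (Fin (d + 1)) F W) (w : ℕ → W),
    (∀ i : Fin (d + 1), w i = v i) ∧ (∀ n : ℕ, d < n → w n = 0) ∧
    (∀ i : ℕ, Even i → 2 ≤ i → i + 1 ≤ d →
      tGen F 0 • w i = ((i : F) * ((d : F) - (i : F) + 1)) • w (i - 1)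
        - (((d : F) - 2 * (i : F) + 1) / 2) • w i) ∧
    (∀ i : ℕ, Odd i → i + 2 ≤ d →
      tGen F 0 • w i = (((d : F) - 2 * (i : F) - 1) / 2) • w i + w (i + 1)) ∧
    (tGen F 0 • w 0 = -(((d : F) + 1) / 2) • w 0) ∧
    (tGen F 0 • w d = -(((d : F) + 1) / 2) • w d) ∧
    (∀ i : ℕ, Even i → 2 ≤ i → i + 1 ≤ d →
      tGen F 1 • w i = ((i : F) * ((i : F) - (d : F) - 1)) • w (i - 1) + a • w i + w (i + 1)) ∧
    (∀ i : ℕ, Odd i → i ≤ d → tGen F 1 • w i = -a • w i) ∧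
    (tGen F 1 • w 0 = a • w 0 + w 1) ∧
    (∀ i : ℕ, Even i → i + 1 ≤ d → tGen F 2 • w i = b • w i) ∧
    (∀ i : ℕ, Odd i → i + 2 ≤ d →
      tGen F 2 • w i = -((sigP F a b c d + (i : F)) * (tauP F a b c d + (i : F))) • w (i - 1)
        - b • w i - w (i + 1)) ∧
    (tGen F 2 • w d = -((sigP F a b c d + (d : F)) * (tauP F a b c d + (d : F))) • w (d - 1)
      - b • w d) ∧
    (∀ i : ℕ, Even i → i + 1 ≤ d →
      tGen F 3 • w i = -((sigP F a b c d + tauP F a b c d + 2 * (i : F) + 2) / 2) • w i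
        - w (i + 1)) ∧
    (∀ i : ℕ, Odd i → i ≤ d →
      tGen F 3 • w i = ((sigP F a b c d + (i : F)) * (tauP F a b c d + (i : F))) • w (i - 1)
        + ((sigP F a b c d + tauP F a b c d + 2 * (i : F)) / 2) • w i)

/-- On `E_d(a,b,c)` the elements `t₀², t₁², t₂², t₃²` act as scalar multiplication by
`(d+1)²/4, a², b², c²` respectively. -/
def EdSquares (a b c : F) (d : ℕ) (W : Type) [AddCommGroup W] [Module (DAHAAlg F) W] :
    Prop :=
  actsAsScalar F (tGen F 0 * tGen F 0) (((d : F) + 1) ^ 2 / 4) W ∧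
  actsAsScalar F (tGen F 1 * tGen F 1) (a ^ 2) W ∧
  actsAsScalar F (tGen F 2 * tGen F 2) (b ^ 2) W ∧
  actsAsScalar F (tGen F 3 * tGen F 3) (c ^ 2) W

/-- `W` is (a copy of) the `(d+1)`-dimensional `𝔥`-module `O_d(a,b,c)` (`d` even):  there is
a basis `v₀, …, v_d` (extended by zero to a sequence `w`) on which `t₀, t₁, t₂, t₃` act by the
prescribed formulas. -/
def IsOdModule (a b c : F) (d : ℕ) (W : Type) [AddCommGroup W] [Module (DAHAAlg F) W] :
    Prop :=
  letI := resF F (DAHAAlg F) W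
  ∃ (v : Module.Basis (Fin (d + 1)) F W) (w : ℕ → W),
    (∀ i : Fin (d + 1), w i = v i) ∧ (∀ n : ℕ, d < n → w n = 0) ∧
    (∀ i : ℕ, Even i → 2 ≤ i → i ≤ d →
      tGen F 0 • w i = -((i : F) * (sigP F a b c d + (i : F))) • w (i - 1)
        + ((sigP F a b c d + 2 * (i : F)) / 2) • w i) ∧
    (∀ i : ℕ, Odd i → i + 1 ≤ d →
      tGen F 0 • w i = -((sigP F a b c d + 2 * (i : F) + 2) / 2) • w i + w (i + 1)) ∧
    (tGen F 0 • w 0 = (sigP F a b c d / 2) • w 0) ∧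
    (∀ i : ℕ, Even i → 2 ≤ i → i + 2 ≤ d →
      tGen F 1 • w i = ((i : F) * (sigP F a b c d + (i : F))) • w (i - 1)
        + (lamP F a b c d / 2) • w i + w (i + 1)) ∧
    (∀ i : ℕ, Odd i → i + 1 ≤ d → tGen F 1 • w i = -(lamP F a b c d / 2) • w i) ∧
    (tGen F 1 • w 0 = (lamP F a b c d / 2) • w 0 + w 1) ∧
    (tGen F 1 • w d = ((d : F) * (sigP F a b c d + (d : F))) • w (d - 1)
      + (lamP F a b c d / 2) • w d) ∧
    (∀ i : ℕ, Even i → i ≤ d → tGen F 2 • w i = (nuP F a b c d / 2) • w i) ∧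
    (∀ i : ℕ, Odd i → i + 1 ≤ d →
      tGen F 2 • w i = (((d : F) - (i : F) - 1) * (tauP F a b c d + (i : F))) • w (i - 1)
        - (nuP F a b c d / 2) • w i - w (i + 1)) ∧
    (∀ i : ℕ, Even i → i + 2 ≤ d →
      tGen F 3 • w i = ((2 * (d : F) + muP F a b c d - 2 * (i : F)) / 2) • w i - w (i + 1)) ∧
    (∀ i : ℕ, Odd i → i + 1 ≤ d →
      tGen F 3 • w i = (((i : F) - (d : F) - 1) * (tauP F a b c d + (i : F))) • w (i - 1)
        - ((2 * (d : F) + muP F a b c d - 2 * (i : F) + 2) / 2) • w i) ∧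
    (tGen F 3 • w d = (muP F a b c d / 2) • w d)

/-- On `O_d(a,b,c)` the elements `t₀², t₁², t₂², t₃²` act as the prescribed scalars. -/
def OdSquares (a b c : F) (d : ℕ) (W : Type) [AddCommGroup W] [Module (DAHAAlg F) W] :
    Prop :=
  actsAsScalar F (tGen F 0 * tGen F 0) (((a + b + c) / 2 - ((d : F) + 1) / 4) ^ 2) W ∧
  actsAsScalar F (tGen F 1 * tGen F 1) (((a - b - c) / 2 - ((d : F) + 1) / 4) ^ 2) W ∧
  actsAsScalar F (tGen F 2 * tGen F 2) (((c - a - b) / 2 - ((d : F) + 1) / 4) ^ 2) W ∧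
  actsAsScalar F (tGen F 3 * tGen F 3) (((b - a - c) / 2 - ((d : F) + 1) / 4) ^ 2) W

/-! ## The `{±1}²`-action on `𝔥` and twisted modules -/

theorem dahaSum : tGen F 0 + tGen F 1 + tGen F 2 + tGen F 3 = -1 := by
  have h := RingQuot.mkAlgHom_rel F (DAHARel.sum (F := F))
  simpa [tGen] using h

theorem dahaSqCentral (i j : Fin 4) :
    tGen F i * tGen F i * tGen F j = tGen F j * (tGen F i * tGen F i) := by
  have h := RingQuot.mkAlgHom_rel F (DAHARel.central (F := F) i j)
  simpa [tGen] using h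

/-- The algebra endomorphism of `𝔥` permuting the generators `t₀, t₁, t₂, t₃` by `π`. -/
def dahaAut (π : Equiv.Perm (Fin 4)) : DAHAAlg F →ₐ[F] DAHAAlg F :=
  RingQuot.liftAlgHom F ⟨FreeAlgebra.lift F (fun i => tGen F (π i)), by
    intro x y h
    cases h with
    | sum =>
        simp only [map_add, map_neg, map_one, FreeAlgebra.lift_ι_apply]
        have h4 : tGen F (π 0) + tGen F (π 1) + tGen F (π 2) + tGen F (π 3)
            = ∑ k : Fin 4, tGen F (π k) := by rw [Fin.sum_univ_four]
        rw [h4, Equiv.sum_comp π (tGen F), Fin.sum_univ_four, dahaSum]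
    | central i j =>
        simp only [map_mul, FreeAlgebra.lift_ι_apply]
        exact dahaSqCentral F (π i) (π j)⟩

/-- The element of the Klein group `{±1}²` acting on `𝔥` as the permutation of
`(t₀, t₁, t₂, t₃)` from Table 1. -/
def permOf (ε : ℤˣ × ℤˣ) : Equiv.Perm (Fin 4) :=
  if ε = (1, 1) then 1
  else if ε = (1, -1) then Equiv.swap 0 1 * Equiv.swap 2 3
  else if ε = (-1, 1) then Equiv.swap 0 2 * Equiv.swap 1 3
  else Equiv.swap 0 3 * Equiv.swap 1 2

/-- The `𝔥`-module `W^ε`: the underlying space of `W` with the action twisted by the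
automorphism of `𝔥` given by the permutation `π` of the generators. -/
def twMod (π : Equiv.Perm (Fin 4)) (W : Type) [AddCommGroup W] [Module (DAHAAlg F) W] :
    Module (DAHAAlg F) W :=
  Module.compHom W (dahaAut F π).toRingHom

/-- The trace of `x` on the twisted module `W^π`. -/
def twTrace (π : Equiv.Perm (Fin 4)) (x : DAHAAlg F) (W : Type) [AddCommGroup W]
    [Module (DAHAAlg F) W] : F :=
  @traceOf F _ (DAHAAlg F) _ _ x W _ (twMod F π W)

/-- `x` acts on the twisted module `W^π` as scalar multiplication by `μ`. -/
def twActsAsScalar (π : Equiv.Perm (Fin 4)) (x : DAHAAlg F) (μ : F) (W : Type)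
    [AddCommGroup W] [Module (DAHAAlg F) W] : Prop :=
  @actsAsScalar F _ (DAHAAlg F) _ _ x μ W _ (twMod F π W)

/-- The twisted module `W^π` is (a copy of) `E_d(a,b,c)`. -/
def twIsEdModule (π : Equiv.Perm (Fin 4)) (a b c : F) (d : ℕ) (W : Type) [AddCommGroup W]
    [Module (DAHAAlg F) W] : Prop :=
  @IsEdModule F _ a b c d W _ (twMod F π W)

end

/-- The factors `(h - d)(a + b + c + d/2 - h + 1)` whose products give the transition
coefficients between the bidiagonal bases of `R_d(a,b,c)` for `A` and for `C`. -/
def transitionFactor {F : Type} [Field F] (a b c : F) (d h : ℕ) : F :=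
  ((h : F) - d) * (a + b + c + (d : F) / 2 - h + 1)

/-- The coefficient at the `i`-th vector of the basis for `A` in the `j`-th vector of the
basis for `C`. -/
def transitionCoeff {F : Type} [Field F] (a b c : F) (d i j : ℕ) : F :=
  (-1) ^ i * (j.choose i : F) * ∏ h ∈ Finset.Ico i j, transitionFactor a b c d h

section Transition

variable {F : Type} [Field F] (a b c : F) (d : ℕ)

theorem transitionCoeff_self (i : ℕ) : transitionCoeff a b c d i i = (-1) ^ i := by
  simp [transitionCoeff]

theorem transitionCoeff_eq_zero_of_lt {i j : ℕ} (h : j < i) :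
    transitionCoeff a b c d i j = 0 := by
  simp [transitionCoeff, Nat.choose_eq_zero_of_lt h]

theorem transitionCoeff_last {i : ℕ} (h : i ≤ d) : transitionCoeff a b c d i (d + 1) = 0 := by
  rw [transitionCoeff, Finset.prod_Ico_succ_top h]
  simp [transitionFactor]

theorem phP_mul_transitionCoeff {i j : ℕ} (h : i ≤ j) :
    phP F a b c d (i + 1) * transitionCoeff a b c d (i + 1) j =
      -(a + b - c + (d : F) / 2 - i) * ((j : F) - i) * transitionCoeff a b c d i j := by
  rcases h.eq_or_lt with rfl | hlt
  · simp [transitionCoeff_eq_zero_of_lt]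
  · have hchoose : (j.choose (i + 1) : F) * (i + 1) = j.choose i * ((j : F) - i) := by
      have := congrArg (Nat.cast (R := F)) (Nat.choose_succ_right_eq j i)
      push_cast [h] at this
      exact this
    simp only [transitionCoeff, Finset.prod_eq_prod_Ico_succ_bot hlt]
    simp only [phP, transitionFactor]
    push_cast
    linear_combination (-(-1) ^ i * ((i : F) - d) * (a + b + c + (d : F) / 2 - i + 1) *
      (a + b - c + (d : F) / 2 - i) *
      ∏ h ∈ Finset.Ico (i + 1) j, ((h : F) - d) * (a + b + c + (d : F) / 2 - h + 1)) * hchoose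

/-- The diagonal entries of the tridiagonal matrix representing `C`. -/
def diagC (i : ℕ) : F :=
  (d : F) / 2 * ((d : F) / 2 + 1) + a * (a + 1) + b * (b + 1) + c * (c + 1) -
    thP F a d i - thP F b d i

theorem transitionCoeff_recurrence [CharZero F] (i j : ℕ) :
    diagC a b c d i * transitionCoeff a b c d i j -
        (if i = 0 then 0 else transitionCoeff a b c d (i - 1) j) -
        phP F a b c d (i + 1) * transitionCoeff a b c d (i + 1) j =
      thP F c d j * transitionCoeff a b c d i j + transitionCoeff a b c d i (j + 1) := by
  rcases lt_or_ge j i with hji | hij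
  · obtain ⟨i, rfl⟩ : ∃ k, i = k + 1 := ⟨i - 1, by omega⟩
    simp only [transitionCoeff_eq_zero_of_lt a b c d hji,
      transitionCoeff_eq_zero_of_lt a b c d (hji.trans (Nat.lt_succ_self _)),
      Nat.add_one_ne_zero, if_false, Nat.add_sub_cancel]
    rcases (Nat.lt_succ_iff.1 hji).eq_or_lt with rfl | hlt
    · simp only [transitionCoeff_self]
      ring
    · rw [transitionCoeff_eq_zero_of_lt a b c d hlt,
        transitionCoeff_eq_zero_of_lt a b c d (Nat.succ_lt_succ hlt)]
      ring
  · rw [phP_mul_transitionCoeff a b c d hij]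
    rcases i with _ | i
    · simp only [transitionCoeff, Finset.prod_Ico_succ_top hij, diagC, thP,
        transitionFactor, if_true, Nat.choose_zero_right]
      push_cast
      ring
    · have hchoose : (j.choose (i + 1) : F) * (i + 1) = j.choose i * ((j : F) - i) := by
        have := congrArg (Nat.cast (R := F)) (Nat.choose_succ_right_eq j i)
        push_cast [(Nat.le_succ i).trans hij] at this
        exact this
      simp only [Nat.add_one_ne_zero, if_false, Nat.add_sub_cancel, transitionCoeff,
        Finset.prod_eq_prod_Ico_succ_bot (Nat.lt_of_succ_le hij),
        Finset.prod_Ico_succ_top hij, Nat.choose_succ_succ]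
      simp only [diagC, thP, transitionFactor]
      push_cast
      generalize (∏ h ∈ Finset.Ico (i + 1) j,
        ((h : F) - d) * (a + b + c + (d : F) / 2 - h + 1)) = P
      linear_combination (-(-1) ^ i * P * (a + b + c + (d : F) / 2 + 1 + d - i - j)) * hchoose

end Transition

/-- An endomorphism which is tridiagonal with the entries of `C` on `R_d(a,b,c)` is lower
bidiagonal with respect to a suitable basis. -/
theorem exists_basis_lowerBidiagonal {F W : Type} [Field F] [CharZero F] [AddCommGroup W]
    [Module F W] (a b c : F) (d : ℕ) (T : Module.End F W) (v : Module.Basis (Fin (d + 1)) F W)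
    (hT : ∀ i : Fin (d + 1), T (v i) = diagC a b c d i • v i -
      (if h : (i : ℕ) + 1 < d + 1 then v ⟨(i : ℕ) + 1, h⟩ else 0) -
      (if (i : ℕ) = 0 then 0 else
        phP F a b c d i • v ⟨(i : ℕ) - 1, lt_of_le_of_lt (Nat.sub_le _ _) i.isLt⟩)) :
    ∃ w : Module.Basis (Fin (d + 1)) F W, ∀ i : Fin (d + 1),
      T (w i) = thP F c d i • w i +
        (if h : (i : ℕ) + 1 < d + 1 then w ⟨(i : ℕ) + 1, h⟩ else 0) := by
  let u : ℕ → W := fun n => if h : n < d + 1 then v ⟨n, h⟩ else 0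
  have hu : ∀ i : Fin (d + 1), u i = v i := fun i => dif_pos i.isLt
  have hu_last : u (d + 1) = 0 := by simp [u]
  have hTu : ∀ n ∈ Finset.range (d + 1), T (u n) = diagC a b c d n • u n - u (n + 1) -
      (if n = 0 then 0 else phP F a b c d n • u (n - 1)) := by
    intro n hn
    have hn' := Finset.mem_range.1 hn
    have h1 : n - 1 < d + 1 := by omega
    simp only [u, dif_pos hn', dif_pos h1]
    exact hT ⟨n, hn'⟩
  let m := transitionCoeff a b c d
  let w : ℕ → W := fun j => ∑ i ∈ Finset.range (d + 1), m i j • u i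
  have hw_last : w (d + 1) = 0 := Finset.sum_eq_zero fun i hi => by
    rw [show m i (d + 1) = 0 from
      transitionCoeff_last a b c d (Nat.lt_succ_iff.1 (Finset.mem_range.1 hi)), zero_smul]
  have hshift_up : ∀ j, ∑ i ∈ Finset.range (d + 1), m i j • u (i + 1) =
      ∑ i ∈ Finset.range (d + 1), (if i = 0 then 0 else m (i - 1) j) • u i := by
    intro j
    rw [Finset.sum_range_succ, hu_last, Finset.sum_range_succ']
    simp
  have hshift_down : ∀ j, ∑ i ∈ Finset.range (d + 1),
        m i j • (if i = 0 then 0 else phP F a b c d i • u (i - 1)) =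
      ∑ i ∈ Finset.range (d + 1), (phP F a b c d (i + 1) * m (i + 1) j) • u i := by
    intro j
    have hphi : phP F a b c d (d + 1) = 0 := by simp [phP]
    rw [Finset.sum_range_succ', Finset.sum_range_succ, hphi]
    simp [smul_smul, mul_comm]
  have hTw : ∀ j, T (w j) = thP F c d j • w j + w (j + 1) := by
    intro j
    have hexpand : T (w j) = ∑ i ∈ Finset.range (d + 1), (diagC a b c d i * m i j) • u i -
        ∑ i ∈ Finset.range (d + 1), m i j • u (i + 1) -
        ∑ i ∈ Finset.range (d + 1),
          m i j • (if i = 0 then 0 else phP F a b c d i • u (i - 1)) := by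
      simp only [w, map_sum, map_smul, ← Finset.sum_sub_distrib]
      refine Finset.sum_congr rfl fun i hi => ?_
      rw [hTu i hi, smul_sub, smul_sub, smul_smul, mul_comm]
    rw [hexpand, hshift_up, hshift_down]
    simp only [w, Finset.smul_sum, ← Finset.sum_sub_distrib, ← Finset.sum_add_distrib,
      smul_smul, ← sub_smul, ← add_smul]
    exact Finset.sum_congr rfl fun i _ => by rw [transitionCoeff_recurrence a b c d i j]
  have hwsum : ∀ j, w j = ∑ k : Fin (d + 1), m k j • v k := fun j => by
    simp only [w, Finset.sum_range, hu]
  have hentry : ∀ i j : Fin (d + 1), v.toMatrix (fun k : Fin (d + 1) => w k) i j = m i j := by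
    intro i j
    rw [Module.Basis.toMatrix_apply, hwsum, v.repr_sum_self]
  have hdet : IsUnit (v.det fun k : Fin (d + 1) => w k) := by
    rw [Module.Basis.det_apply, Matrix.det_of_isUpperTriangular]
    · refine isUnit_iff_ne_zero.2 (Finset.prod_ne_zero_iff.2 fun i _ => ?_)
      rw [hentry, show m i i = (-1) ^ (i : ℕ) from transitionCoeff_self a b c d i]
      exact pow_ne_zero _ (neg_ne_zero.2 one_ne_zero)
    · intro i j hij
      rw [hentry]
      exact transitionCoeff_eq_zero_of_lt a b c d hij
  obtain ⟨hli, hspan⟩ := (Module.Basis.is_basis_iff_det v).2 hdet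
  refine ⟨Module.Basis.mk hli hspan.ge, fun i => ?_⟩
  simp only [Module.Basis.mk_apply, hTw]
  split_ifs with h
  · rfl
  · rw [show (i : ℕ) + 1 = d + 1 by omega, hw_last]

/-- For any integer `d ≥ 0` and `a, b, c ∈ F` there is a basis of
`R_d(a,b,c)` with respect to which `C` is represented by the lower bidiagonal matrix with
diagonal entries `θᵉᵢ = (c+d/2-i)(c+d/2-i+1)` and subdiagonal entries `1`. -/
theorem stmt9 (F : Type) [Field F] [IsAlgClosed F] [CharZero F] (d : ℕ) (a b c : F)
    (V : Type) [AddCommGroup V] [Module (RacahAlg F) V]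
    (hV : IsRdModule F a b c d V) :
    letI := resF F (RacahAlg F) V
    ∃ v : Module.Basis (Fin (d + 1)) F V, ∀ i : Fin (d + 1),
      rC F • (v i : V) = thP F c d i • v i +
        (if h : (i : ℕ) + 1 < d + 1 then v ⟨(i : ℕ) + 1, h⟩ else 0) := by
  let _ := resF F (RacahAlg F) V
  have _ := resF_tower F (RacahAlg F) V rfl
  obtain ⟨v, hA, hB, hδ⟩ := hV
  refine exists_basis_lowerBidiagonal a b c d (opOf F (rC F) V) v fun i => ?_
  have hC : rC F = rDelta F - rA F - rB F := by
    rw [rDelta]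
    abel
  change rC F • v i = _
  rw [hC, sub_smul, sub_smul, hA, hB, hδ, diagC, sub_smul, sub_smul]
  abel
end

section
/- Let d ≥ 0 be an integer and a, b, c ∈ F, and suppose the ℜ-module R_d(a,b,c) is irreducible. Let (X,Y) denote any one of the pairs (A,B), (B,C), (C,A). Then the following are equivalent: (i) X and Y act diagonalizably on R_d(a,b,c); (ii) X and Y act multiplicity-freely on R_d(a,b,c); (iii) X, Y act as a Leonard pair on R_d(a,b,c). -/
open FreeAlgebra

/-! ## Multiplicity-free operators -/

section Operators

variable {K M : Type*} [Field K] [AddCommGroup M] [Module K M]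

/-- An eigenvector of an unreduced upper Hessenberg operator has nonzero last coordinate. -/
theorem eq_zero_of_hessenberg {d : ℕ} (v : Module.Basis (Fin (d + 1)) K M) {T : Module.End K M}
    (hzero : ∀ i j : Fin (d + 1), (j : ℕ) + 1 < i → v.repr (T (v j)) i = 0)
    (hne : ∀ i j : Fin (d + 1), (i : ℕ) = j + 1 → v.repr (T (v j)) i ≠ 0)
    {μ : K} {u : M} (hu : T u = μ • u) (hlast : v.repr u (Fin.last d) = 0) : u = 0 := by
  have hrow : ∀ i, ∑ j, v.repr u j * v.repr (T (v j)) i = μ * v.repr u i := by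
    intro i
    have hsum : T u = ∑ j, v.repr u j • T (v j) := by
      conv_lhs => rw [← v.sum_repr u, map_sum]
      simp only [map_smul]
    simpa [Finsupp.finsetSum_apply] using congrArg (fun w => v.repr w i) (hsum.symm.trans hu)
  have key : ∀ k : ℕ, ∀ j : Fin (d + 1), d - j = k → v.repr u j = 0 := by
    intro k
    induction k using Nat.strong_induction_on with
    | _ k ih =>
      intro j hj
      by_cases hjd : (j : ℕ) = d
      · rwa [show j = Fin.last d from Fin.ext hjd]
      · have hlt : (j : ℕ) + 1 < d + 1 := by omega
        have hgt : ∀ l : Fin (d + 1), (j : ℕ) < l → v.repr u l = 0 := fun l hl =>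
          ih (d - l) (by omega) l rfl
        have h := hrow ⟨j + 1, hlt⟩
        rw [hgt ⟨j + 1, hlt⟩ (Nat.lt_succ_self _), mul_zero, Finset.sum_eq_single j] at h
        · exact (mul_eq_zero.1 h).resolve_right (hne _ _ rfl)
        · intro l _ hl
          rcases lt_or_gt_of_ne (fun e => hl (Fin.ext e) : (l : ℕ) ≠ j) with h1 | h1
          · rw [hzero ⟨j + 1, hlt⟩ l (Nat.succ_lt_succ h1), mul_zero]
          · rw [hgt l h1, zero_mul]
        · simp
  exact v.repr.map_eq_zero_iff.1 (Finsupp.ext fun j => key _ j rfl)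

theorem finrank_eigenspace_le_one_of_hessenberg {d : ℕ} (v : Module.Basis (Fin (d + 1)) K M)
    {T : Module.End K M}
    (hzero : ∀ i j : Fin (d + 1), (j : ℕ) + 1 < i → v.repr (T (v j)) i = 0)
    (hne : ∀ i j : Fin (d + 1), (i : ℕ) = j + 1 → v.repr (T (v j)) i ≠ 0) (μ : K) :
    Module.finrank K (T.eigenspace μ) ≤ 1 := by
  have hinj : Function.Injective ((v.coord (Fin.last d)).comp (T.eigenspace μ).subtype) := by
    rw [← LinearMap.ker_eq_bot, LinearMap.ker_eq_bot']
    intro u hu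
    exact Subtype.ext (eq_zero_of_hessenberg v hzero hne
      (Module.End.mem_eigenspace_iff.1 u.2) (by simpa using hu))
  simpa using LinearMap.finrank_le_finrank_of_injective hinj

theorem finrank_maxGenEigenspace_eq_one [FiniteDimensional K M] {T : Module.End K M}
    (hle : ∀ μ, Module.finrank K (T.eigenspace μ) ≤ 1) (htop : ⨆ μ, T.eigenspace μ = ⊤)
    {μ : K} (hμ : T.HasEigenvalue μ) : Module.finrank K (T.maxGenEigenspace μ) = 1 := by
  have h := (T.independent_maxGenEigenspace.le_iff_eq_of_iSup_eq_top htop).1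
    (fun _ => Module.End.eigenspace_le_maxGenEigenspace)
  rw [← congrFun h μ]
  refine le_antisymm (hle μ) ?_
  rw [Nat.one_le_iff_ne_zero, Ne, Submodule.finrank_eq_zero]
  exact hμ

theorem maxGenEigenspace_eq_eigenspace_of_finrank [FiniteDimensional K M] {T : Module.End K M}
    (hT : ∀ μ, T.HasEigenvalue μ → Module.finrank K (T.maxGenEigenspace μ) = 1) (μ : K) :
    T.maxGenEigenspace μ = T.eigenspace μ := by
  by_cases hμ : T.HasEigenvalue μ
  · refine (Submodule.eq_of_le_of_finrank_le Module.End.eigenspace_le_maxGenEigenspace ?_).symm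
    rw [hT μ hμ, Nat.one_le_iff_ne_zero, Ne, Submodule.finrank_eq_zero]
    exact hμ
  · have h0 : T.eigenspace μ = ⊥ := not_not.1 hμ
    rw [h0, eq_bot_iff]
    intro u hu
    obtain ⟨k, hk⟩ := (T.mem_maxGenEigenspace μ u).1 hu
    have hinj : Function.Injective (T - μ • (1 : Module.End K M)) := by
      rw [← LinearMap.ker_eq_bot]
      simpa [Module.End.eigenspace_def, Algebra.algebraMap_eq_smul_one] using h0
    have hinjk : Function.Injective ((T - μ • (1 : Module.End K M)) ^ k) := by
      rw [Module.End.coe_pow]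
      exact hinj.iterate k
    exact hinjk (by simpa using hk)

theorem iSup_eigenspace_eq_top_of_finrank [IsAlgClosed K] [FiniteDimensional K M]
    {T : Module.End K M}
    (hT : ∀ μ, T.HasEigenvalue μ → Module.finrank K (T.maxGenEigenspace μ) = 1) :
    ⨆ μ, T.eigenspace μ = ⊤ := by
  simpa only [maxGenEigenspace_eq_eigenspace_of_finrank hT] using T.iSup_maxGenEigenspace_eq_top

theorem iSup_eigenspace_eq_top_of_isDiag {n : ℕ} (b : Module.Basis (Fin n) K M)
    {T : Module.End K M} (h : (LinearMap.toMatrix b b T).IsDiag) : ⨆ μ, T.eigenspace μ = ⊤ := by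
  rw [eq_top_iff, ← b.span_eq, Submodule.span_le]
  rintro _ ⟨j, rfl⟩
  refine Submodule.mem_iSup_of_mem (b.repr (T (b j)) j) (Module.End.mem_eigenspace_iff.2 ?_)
  conv_lhs => rw [← b.sum_repr (T (b j))]
  refine Finset.sum_eq_single j (fun i _ hij => ?_) (by simp)
  have hzero : LinearMap.toMatrix b b T i j = 0 := h hij
  rw [← LinearMap.toMatrix_apply, hzero, zero_smul]

/-- A diagonalizable operator with simple eigenvalues has an eigenbasis indexed by its
eigenvalues. -/
theorem exists_eigenbasis [FiniteDimensional K M] {T : Module.End K M}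
    (hle : ∀ μ, Module.finrank K (T.eigenspace μ) ≤ 1) (htop : ⨆ μ, T.eigenspace μ = ⊤) :
    ∃ w : Module.Basis T.Eigenvalues K M, ∀ i, T (w i) = (i : K) • w i := by
  choose e he using fun i : T.Eigenvalues => Module.End.HasEigenvalue.exists_hasEigenvector i.2
  have hli : LinearIndependent K e :=
    T.eigenvectors_linearIndependent' (fun i : T.Eigenvalues => (i : K))
      Subtype.val_injective e he
  have hspan : ⊤ ≤ Submodule.span K (Set.range e) := by
    rw [← htop]
    refine iSup_le fun μ u hu => ?_
    by_cases hμ : T.HasEigenvalue μ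
    · obtain ⟨x, hx⟩ := finrank_le_one_iff.1 (hle μ)
      obtain ⟨r, hr⟩ := hx ⟨e ⟨μ, hμ⟩, (he ⟨μ, hμ⟩).1⟩
      obtain ⟨s, hs⟩ := hx ⟨u, hu⟩
      have hr' : r • (x : M) = e ⟨μ, hμ⟩ := congrArg Subtype.val hr
      have hs' : s • (x : M) = u := congrArg Subtype.val hs
      have hr0 : r ≠ 0 := by
        rintro rfl
        exact (he ⟨μ, hμ⟩).2 (by rw [← hr', zero_smul])
      have : u = (s * r⁻¹) • e ⟨μ, hμ⟩ := by
        rw [← hr', smul_smul, mul_assoc, inv_mul_cancel₀ hr0, mul_one, hs']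
      rw [this]
      exact Submodule.smul_mem _ _ (Submodule.subset_span ⟨_, rfl⟩)
    · have h0 : T.eigenspace μ = ⊥ := not_not.1 hμ
      rw [h0, Submodule.mem_bot] at hu
      rw [hu]
      exact Submodule.zero_mem _
  refine ⟨Module.Basis.mk hli hspan, fun i => ?_⟩
  rw [Module.Basis.mk_apply]
  exact Module.End.mem_eigenspace_iff.1 (he i).1

end Operators

/-! ## Spectra of Racah type -/

section Spectrum

variable {K : Type*} [Field K]

theorem racah_adjacent_factor (x p q : K) :
    ((x + p) * (x + p + 1) - (x + q) * (x + q + 1)) ^ 2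
      - 2 * ((x + p) * (x + p + 1) + (x + q) * (x + q + 1))
      = ((2 * x + 1 + p + q) ^ 2 - 1) * ((p - q) ^ 2 - 1) := by
  ring

/-- A strongly connected digraph on a finite set of scalars whose edges join scalars
`θ ≠ θ'` with `(θ - θ')² = 2(θ + θ')` embeds in a path. -/
theorem exists_path_embedding [IsAlgClosed K] [CharZero K] {J : Type*} [Nonempty J] {μ : J → K}
    (hμ : Function.Injective μ) {E : J → J → Prop}
    (hE : ∀ i j, i ≠ j → E i j → (μ i - μ j) ^ 2 = 2 * (μ i + μ j))
    (hconn : ∀ s : Set J, s.Nonempty → (∀ i ∈ s, ∀ j, E i j → j ∈ s) → s = Set.univ) :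
    ∃ r : J → ℤ, Function.Injective r ∧
      ∀ i j, i ≠ j → E i j → r i = r j + 1 ∨ r j = r i + 1 := by
  obtain ⟨i₀⟩ := ‹Nonempty J›
  obtain ⟨x, hx⟩ : ∃ x : K, x * (x + 1) = μ i₀ := by
    obtain ⟨s, hs⟩ := IsAlgClosed.exists_pow_nat_eq (4 * μ i₀ + 1) (n := 2) two_pos
    refine ⟨(s - 1) / 2, ?_⟩
    field_simp
    linear_combination hs
  have hex : ∀ i, ∃ k : ℤ, μ i = (x + k) * (x + k + 1) := by
    have := hconn {i | ∃ k : ℤ, μ i = (x + k) * (x + k + 1)} ⟨i₀, 0, by simp [hx]⟩ ?_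
    · intro i
      have hi : i ∈ (Set.univ : Set J) := Set.mem_univ i
      rwa [← this] at hi
    · rintro i ⟨k, hk⟩ j hij
      by_cases hne : i = j
      · exact hne ▸ ⟨k, hk⟩
      have h := hE i j hne hij
      rw [hk] at h
      have hprod : (μ j - (x + ((k - 1 : ℤ) : K)) * (x + ((k - 1 : ℤ) : K) + 1)) *
          (μ j - (x + ((k + 1 : ℤ) : K)) * (x + ((k + 1 : ℤ) : K) + 1)) = 0 := by
        push_cast
        linear_combination h
      rcases mul_eq_zero.1 hprod with h1 | h1
      · exact ⟨k - 1, sub_eq_zero.1 h1⟩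
      · exact ⟨k + 1, sub_eq_zero.1 h1⟩
  -- Reflecting `k` in the symmetry centre makes `k` unique when `2x + 1` is an integer.
  have hex' : ∀ i, ∃ k : ℤ, μ i = (x + k) * (x + k + 1) ∧
      ∀ m : ℤ, 2 * x + 1 = m → 0 ≤ m + 2 * k := by
    intro i
    obtain ⟨k, hk⟩ := hex i
    by_cases hm : ∃ m : ℤ, 2 * x + 1 = m
    · obtain ⟨m, hm⟩ := hm
      have huniq : ∀ m' : ℤ, 2 * x + 1 = m' → m' = m := fun m' hm' => by
        exact_mod_cast hm'.symm.trans hm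
      by_cases h0 : 0 ≤ m + 2 * k
      · exact ⟨k, hk, fun m' hm' => huniq m' hm' ▸ h0⟩
      · refine ⟨-m - k, ?_, fun m' hm' => ?_⟩
        · rw [hk]
          push_cast
          rw [← hm]
          ring
        · rw [huniq m' hm']
          omega
    · exact ⟨k, hk, fun m hm' => absurd ⟨m, hm'⟩ hm⟩
  choose r hr hrm using hex'
  have hsum : ∀ (i j : J) (t : ℤ), 2 * x + 1 + r i + r j = t →
      2 * x + 1 = ((t - r i - r j : ℤ) : K) := by
    intro i j t h
    push_cast
    linear_combination h
  refine ⟨r, fun i j hij => hμ (by rw [hr i, hr j, hij]), fun i j hne hij => ?_⟩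
  have hrne : r i ≠ r j := fun h => hne (hμ (by rw [hr i, hr j, h]))
  have h := hE i j hne hij
  rw [← sub_eq_zero, hr i, hr j, racah_adjacent_factor] at h
  rcases mul_eq_zero.1 h with h | h
  · have key : ∃ t : ℤ, (t = 1 ∨ t = -1) ∧ 2 * x + 1 + r i + r j = t := by
      rcases sq_eq_one_iff.1 (sub_eq_zero.1 h) with h | h
      · exact ⟨1, Or.inl rfl, by simpa using h⟩
      · exact ⟨-1, Or.inr rfl, by simpa using h⟩
    obtain ⟨t, ht, h⟩ := key
    have h1 := hrm i _ (hsum i j t h)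
    have h2 := hrm j _ (hsum i j t h)
    omega
  · have h' : (r i - r j) ^ 2 = 1 := by exact_mod_cast sub_eq_zero.1 h
    rcases sq_eq_one_iff.1 h' with h | h <;> omega

end Spectrum

section Leonard

theorem exists_equiv_fin_path {J : Type*} [Fintype J] {E : J → J → Prop} {r : J → ℤ}
    (hr : Function.Injective r)
    (hadj : ∀ i j, i ≠ j → E i j → r i = r j + 1 ∨ r j = r i + 1)
    (hconn : ∀ s : Set J, s.Nonempty → (∀ i ∈ s, ∀ j, E i j → j ∈ s) → s = Set.univ) :
    ∃ (n : ℕ) (σ : Fin n ≃ J),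
      (∀ i j, i ≠ j → E (σ i) (σ j) → (i : ℕ) = j + 1 ∨ (j : ℕ) = i + 1) ∧
      ∀ i j : Fin n, ((i : ℕ) = j + 1 ∨ (j : ℕ) = i + 1) → E (σ i) (σ j) := by
  let _ : LinearOrder J := LinearOrder.lift' r hr
  let σ := Fintype.orderIsoFinOfCardEq J rfl
  have hlt : ∀ i j, r (σ i) < r (σ j) ↔ i < j := fun i j => σ.lt_iff_lt
  have hle : ∀ i j, i ≤ j → r (σ i) ≤ r (σ j) := fun i j h => σ.monotone h
  have hstep : ∀ i j, r (σ i) = r (σ j) + 1 → (i : ℕ) = j + 1 := by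
    intro i j h
    have hji : j < i := (hlt j i).1 (by omega)
    by_contra hne
    have h1 := (hlt j ⟨j + 1, by omega⟩).2 (Fin.lt_def.2 (Nat.lt_succ_self _))
    have h2 := (hlt ⟨j + 1, by omega⟩ i).2 (Fin.lt_def.2 (by simp; omega))
    omega
  have hcoord : ∀ i j, i ≠ j → E (σ i) (σ j) → (i : ℕ) = j + 1 ∨ (j : ℕ) = i + 1 :=
    fun i j hij hE => (hadj _ _ (σ.injective.ne hij) hE).imp (hstep i j) (hstep j i)
  refine ⟨_, σ.toEquiv, hcoord, ?_⟩
  rintro i j (hij | hij)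
  · by_contra hE
    have hs := hconn (σ '' Set.Ici i) ⟨σ i, i, le_refl i, rfl⟩ ?_
    · have hj : σ j ∈ σ '' Set.Ici i := hs ▸ Set.mem_univ _
      obtain ⟨k, hk, hkj⟩ := hj
      rw [σ.injective hkj] at hk
      have : (i : ℕ) ≤ j := hk
      omega
    · rintro _ ⟨k, hk, rfl⟩ y hy
      obtain ⟨l, rfl⟩ := σ.surjective y
      refine ⟨l, ?_, rfl⟩
      by_contra hl
      have hk' : (i : ℕ) ≤ k := hk
      have hl' : ¬ (i : ℕ) ≤ l := hl
      have hkl := hcoord k l (by rintro rfl; exact hl hk) hy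
      have e1 : k = i := Fin.ext (by omega)
      have e2 : l = j := Fin.ext (by omega)
      subst e1 e2
      exact hE hy
  · by_contra hE
    have hs := hconn (σ '' Set.Iic i) ⟨σ i, i, le_refl i, rfl⟩ ?_
    · have hj : σ j ∈ σ '' Set.Iic i := hs ▸ Set.mem_univ _
      obtain ⟨k, hk, hkj⟩ := hj
      rw [σ.injective hkj] at hk
      have : (j : ℕ) ≤ i := hk
      omega
    · rintro _ ⟨k, hk, rfl⟩ y hy
      obtain ⟨l, rfl⟩ := σ.surjective y
      refine ⟨l, ?_, rfl⟩
      by_contra hl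
      have hk' : (k : ℕ) ≤ i := hk
      have hl' : ¬ (l : ℕ) ≤ i := hl
      have hkl := hcoord k l (by rintro rfl; exact hl hk) hy
      have e1 : k = i := Fin.ext (by omega)
      have e2 : l = j := Fin.ext (by omega)
      subst e1 e2
      exact hE hy

/-- If `T` is multiplicity-free and diagonalizable, `T, S` satisfy a Racah-type relation and
act irreducibly, then `S` is irreducible tridiagonal in a suitably ordered eigenbasis of `T`. -/
theorem exists_isDiag_isIrrTridiag {K M : Type} [Field K] [IsAlgClosed K] [CharZero K]
    [AddCommGroup M] [Module K M] [FiniteDimensional K M] [Nontrivial M]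
    {T S G : Module.End K M} (hG : G * T = T * G)
    (hrel : T * T * S - 2 * (T * S * T) + S * T * T - 2 * (T * S) - 2 * (S * T) = G)
    (hirr : ∀ p : Submodule K M, (∀ u ∈ p, T u ∈ p) → (∀ u ∈ p, S u ∈ p) → p = ⊥ ∨ p = ⊤)
    (hle : ∀ μ, Module.finrank K (T.eigenspace μ) ≤ 1) (htop : ⨆ μ, T.eigenspace μ = ⊤) :
    ∃ (n : ℕ) (b : Module.Basis (Fin n) K M),
      (LinearMap.toMatrix b b T).IsDiag ∧ IsIrrTridiag K (LinearMap.toMatrix b b S) := by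
  obtain ⟨w, hw⟩ := exists_eigenbasis hle htop
  have hT : ∀ u j, w.repr (T u) j = (j : K) * w.repr u j := by
    intro u j
    have h : T u = ∑ i, w.repr u i • T (w i) := by
      conv_lhs => rw [← w.sum_repr u, map_sum]
      simp only [map_smul]
    rw [h, map_sum, Finsupp.finsetSum_apply, Finset.sum_eq_single j]
    · simp [hw, mul_comm]
    · intro i _ hij
      simp [hw, Finsupp.single_eq_of_ne hij.symm]
    · simp
  have hGw : ∀ i j, i ≠ j → w.repr (G (w i)) j = 0 := by
    intro i j hij
    have h := congrArg (fun f : Module.End K M => w.repr (f (w i)) j) hG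
    simp only [Module.End.mul_apply, hT, hw, map_smul, Finsupp.smul_apply, smul_eq_mul] at h
    have hne : (i : K) - j ≠ 0 := sub_ne_zero.2 fun e => hij (Subtype.ext e)
    refine (mul_eq_zero.1 (?_ : ((i : K) - j) * _ = 0)).resolve_left hne
    linear_combination h
  have hE : ∀ i j : T.Eigenvalues, i ≠ j → w.repr (S (w i)) j ≠ 0 →
      ((i : K) - j) ^ 2 = 2 * ((i : K) + j) := by
    intro i j hij hne
    have h := congrArg (fun f : Module.End K M => w.repr (f (w i)) j) hrel
    simp only [two_mul, Module.End.mul_apply, LinearMap.add_apply, LinearMap.sub_apply, map_add,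
      map_sub, Finsupp.add_apply, Finsupp.sub_apply, hT, hw, map_smul, Finsupp.smul_apply,
      smul_eq_mul, hGw i j hij] at h
    have h' : w.repr (S (w i)) j * (((i : K) - j) ^ 2 - 2 * ((i : K) + j)) = 0 := by
      linear_combination h
    exact sub_eq_zero.1 ((mul_eq_zero.1 h').resolve_left hne)
  have hconn : ∀ s : Set T.Eigenvalues, s.Nonempty →
      (∀ i ∈ s, ∀ j, w.repr (S (w i)) j ≠ 0 → j ∈ s) → s = Set.univ := by
    rintro s ⟨i₀, hi₀⟩ hs
    have hstable : ∀ f : Module.End K M, (∀ i ∈ s, f (w i) ∈ Submodule.span K (w '' s)) →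
        ∀ u ∈ Submodule.span K (w '' s), f u ∈ Submodule.span K (w '' s) := by
      intro f hf
      have : Submodule.span K (w '' s) ≤ (Submodule.span K (w '' s)).comap f := by
        rw [Submodule.span_le]
        rintro _ ⟨i, hi, rfl⟩
        exact hf i hi
      exact this
    have hTs : ∀ i ∈ s, T (w i) ∈ Submodule.span K (w '' s) := fun i hi => by
      rw [hw]
      exact Submodule.smul_mem _ _ (Submodule.subset_span ⟨i, hi, rfl⟩)
    have hSs : ∀ i ∈ s, S (w i) ∈ Submodule.span K (w '' s) := fun i hi => by
      rw [w.mem_span_image]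
      exact fun j hj => hs i hi j (Finsupp.mem_support_iff.1 hj)
    rcases hirr (Submodule.span K (w '' s)) (hstable T hTs) (hstable S hSs) with h | h
    · exact absurd ((Submodule.span_eq_bot.1 h) _ ⟨i₀, hi₀, rfl⟩) (w.ne_zero i₀)
    · refine Set.eq_univ_of_forall fun j => ?_
      have hj : w j ∈ Submodule.span K (w '' s) := h ▸ Submodule.mem_top
      rw [w.mem_span_image] at hj
      exact hj (by simp)
  have : Nonempty T.Eigenvalues := w.index_nonempty
  obtain ⟨r, hr, hadj⟩ := exists_path_embedding (μ := fun i : T.Eigenvalues => (i : K))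
    Subtype.val_injective hE hconn
  obtain ⟨n, σ, hσ, hσ'⟩ := exists_equiv_fin_path hr hadj hconn
  refine ⟨n, w.reindex σ.symm, fun i j hij => ?_, fun i j hne => ?_, fun i j hij => ?_⟩
  · change LinearMap.toMatrix _ _ T i j = 0
    rw [LinearMap.toMatrix_apply]
    simp [hw, Finsupp.single_eq_of_ne hij]
  · rw [LinearMap.toMatrix_apply] at hne
    by_cases hij : i = j
    · exact Or.inl (congrArg _ hij)
    · exact Or.inr (hσ j i (Ne.symm hij) (by simpa using hne)).symm
  · rw [LinearMap.toMatrix_apply]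
    simpa using hσ' j i hij.symm

end Leonard

/-! ## The Racah relations between two of `A, B, C` -/

section RacahRelations

theorem racah_pair_relation {R : Type*} [Ring R] {x y z t : R}
    (hxy : x * y - y * x = 2 * t) (hzx : z * x - x * z = 2 * t)
    (hα : (x * t - t * x + x * z - y * x) * x = x * (x * t - t * x + x * z - y * x)) :
    ∃ g : R, g * x = x * g ∧
      x * x * y - 2 * (x * y * x) + y * x * x - 2 * (x * y) - 2 * (y * x) = g := by
  set α := x * t - t * x + x * z - y * x with hαdef
  have hδ : (x + y + z) * x = x * (x + y + z) := by
    have h : (x + y + z) * x - x * (x + y + z) = (z * x - x * z) - (x * y - y * x) := by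
      noncomm_ring
    rw [hzx, hxy, sub_self] at h
    exact sub_eq_zero.1 h
  refine ⟨2 * α - 2 * (x * (x + y + z)) + 2 * (x * x), ?_, ?_⟩
  · have e1 : 2 * α * x = x * (2 * α) := by rw [mul_assoc, hα]; noncomm_ring
    have e2 : 2 * (x * (x + y + z)) * x = x * (2 * (x * (x + y + z))) := by
      rw [mul_assoc, mul_assoc, hδ]; noncomm_ring
    rw [add_mul, sub_mul, e1, e2]
    noncomm_ring
  · have h : x * (x * y - y * x) - (x * y - y * x) * x = x * (2 * t) - 2 * t * x := by rw [hxy]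
    have h' : x * x * y - 2 * (x * y * x) + y * x * x = x * (2 * t) - 2 * t * x := by
      rw [← h]; noncomm_ring
    rw [h', hαdef]
    noncomm_ring

theorem racah_pair_relation_symm {R : Type*} [Ring R] {x y z t : R}
    (hxy : x * y - y * x = 2 * t) (hyz : y * z - z * y = 2 * t)
    (hβ : (y * t - t * y + y * x - z * y) * y = y * (y * t - t * y + y * x - z * y)) :
    ∃ g : R, g * y = y * g ∧
      y * y * x - 2 * (y * x * y) + x * y * y - 2 * (y * x) - 2 * (x * y) = g := by
  set β := y * t - t * y + y * x - z * y with hβdef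
  have hδ : (x + y + z) * y = y * (x + y + z) := by
    have h : (x + y + z) * y - y * (x + y + z) = (x * y - y * x) - (y * z - z * y) := by
      noncomm_ring
    rw [hyz, hxy, sub_self] at h
    exact sub_eq_zero.1 h
  refine ⟨-(2 * β) - 2 * ((x + y + z) * y) + 2 * (y * y), ?_, ?_⟩
  · have e1 : 2 * β * y = y * (2 * β) := by rw [mul_assoc, hβ]; noncomm_ring
    have e2 : 2 * ((x + y + z) * y) * y = y * (2 * ((x + y + z) * y)) := by
      rw [hδ, mul_assoc, mul_assoc, hδ]; noncomm_ring
    rw [add_mul, sub_mul, neg_mul, e1, e2]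
    noncomm_ring
  · have h : y * (x * y - y * x) - (x * y - y * x) * y = y * (2 * t) - 2 * t * y := by rw [hxy]
    have h' : y * y * x - 2 * (y * x * y) + x * y * y = -(y * (2 * t) - 2 * t * y) := by
      rw [← h]; noncomm_ring
    rw [h', hβdef]
    noncomm_ring

variable (F : Type) [Field F]

theorem rA_mul_rB : rA F * rB F - rB F * rA F = 2 * rD F := by
  simpa [rA, rB, rD, two_mul] using RingQuot.mkAlgHom_rel F (RacahRel.AB (F := F))

theorem rB_mul_rC : rB F * rC F - rC F * rB F = 2 * rD F := by
  simpa [rB, rC, rD, two_mul] using RingQuot.mkAlgHom_rel F (RacahRel.BC (F := F))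

theorem rC_mul_rA : rC F * rA F - rA F * rC F = 2 * rD F := by
  simpa [rC, rA, rD, two_mul] using RingQuot.mkAlgHom_rel F (RacahRel.CA (F := F))

theorem rAlpha_commute :
    (rA F * rD F - rD F * rA F + rA F * rC F - rB F * rA F) * rA F
      = rA F * (rA F * rD F - rD F * rA F + rA F * rC F - rB F * rA F) := by
  simpa [rA, rB, rC, rD, alphaFree] using
    RingQuot.mkAlgHom_rel F (RacahRel.alphaC (F := F) 0)

theorem rBeta_commute :
    (rB F * rD F - rD F * rB F + rB F * rA F - rC F * rB F) * rB F
      = rB F * (rB F * rD F - rD F * rB F + rB F * rA F - rC F * rB F) := by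
  simpa [rA, rB, rC, rD, betaFree] using
    RingQuot.mkAlgHom_rel F (RacahRel.betaC (F := F) 1)

theorem rGamma_commute :
    (rC F * rD F - rD F * rC F + rC F * rB F - rA F * rC F) * rC F
      = rC F * (rC F * rD F - rD F * rC F + rC F * rB F - rA F * rC F) := by
  simpa [rA, rB, rC, rD, gammaFree] using
    RingQuot.mkAlgHom_rel F (RacahRel.gammaC (F := F) 2)

variable {F}

/-- A subspace stable under the generators of `ℜ` is stable under `ℜ`. -/
theorem smul_mem_of_generators {V : Type*} [AddCommGroup V] [Module F V] [Module (RacahAlg F) V]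
    [IsScalarTower F (RacahAlg F) V] (p : Submodule F V)
    (hA : ∀ u ∈ p, rA F • u ∈ p) (hB : ∀ u ∈ p, rB F • u ∈ p) (hC : ∀ u ∈ p, rC F • u ∈ p)
    (hD : ∀ u ∈ p, rD F • u ∈ p) (x : RacahAlg F) : ∀ u ∈ p, x • u ∈ p := by
  obtain ⟨y, rfl⟩ := RingQuot.mkAlgHom_surjective F (RacahRel F) x
  induction y using FreeAlgebra.induction with
  | grade0 r =>
    intro u hu
    rw [AlgHom.commutes, algebraMap_smul]
    exact p.smul_mem r hu
  | grade1 i => fin_cases i <;> assumption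
  | mul a b ha hb =>
    intro u hu
    rw [map_mul, mul_smul]
    exact ha _ (hb u hu)
  | add a b ha hb =>
    intro u hu
    rw [map_add, add_smul]
    exact p.add_mem (ha u hu) (hb u hu)

/-- A subspace of an irreducible `ℜ`-module stable under `A, B, C` is trivial. -/
theorem eq_bot_or_eq_top_of_stable [CharZero F] {V : Type*} [AddCommGroup V] [Module F V]
    [Module (RacahAlg F) V] [IsScalarTower F (RacahAlg F) V] [IsSimpleModule (RacahAlg F) V]
    (p : Submodule F V) (hA : ∀ u ∈ p, rA F • u ∈ p) (hB : ∀ u ∈ p, rB F • u ∈ p)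
    (hC : ∀ u ∈ p, rC F • u ∈ p) : p = ⊥ ∨ p = ⊤ := by
  have hD : ∀ u ∈ p, rD F • u ∈ p := by
    intro u hu
    have h : (2 : F) • rD F • u = rA F • rB F • u - rB F • rA F • u := by
      rw [← mul_smul, ← mul_smul, ← sub_smul, rA_mul_rB, two_smul, two_mul, add_smul]
    have h' : (2 : F) • rD F • u ∈ p := h ▸ p.sub_mem (hA _ (hB u hu)) (hB _ (hA u hu))
    exact (p.smul_mem_iff two_ne_zero).1 h'
  let q : Submodule (RacahAlg F) V :=
    { p.toAddSubmonoid with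
      smul_mem' := fun x u hu => smul_mem_of_generators p hA hB hC hD x u hu }
  have hq : (q : Set V) = p := rfl
  rcases eq_bot_or_eq_top q with h | h
  · refine Or.inl (SetLike.coe_injective ?_)
    rw [← hq, h]
    rfl
  · refine Or.inr (SetLike.coe_injective ?_)
    rw [← hq, h]
    rfl

end RacahRelations

/-! ## The action of `A, B, C` on `R_d(a,b,c)` -/

section RdModules

variable {F : Type} [Field F] {V : Type} [AddCommGroup V] [Module F V] [Module (RacahAlg F) V]
  {a b c κ : F} {d : ℕ} {v : Module.Basis (Fin (d + 1)) F V}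

theorem rC_smul (hδ : ∀ u : V, rDelta F • u = κ • u) (u : V) :
    rC F • u = κ • u - rA F • u - rB F • u := by
  rw [← hδ u, rDelta, add_smul, add_smul]
  abel

theorem repr_rA_smul
    (hA : ∀ i : Fin (d + 1), rA F • v i = thP F a d i • v i +
      (if h : (i : ℕ) + 1 < d + 1 then v ⟨(i : ℕ) + 1, h⟩ else 0)) (i j : Fin (d + 1)) :
    v.repr (rA F • v j) i
      = (if (i : ℕ) = j then thP F a d j else 0) + (if (i : ℕ) = j + 1 then 1 else 0) := by
  rw [hA]
  by_cases h : (j : ℕ) + 1 < d + 1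
  · simp [h, Finsupp.single_apply, Fin.ext_iff, eq_comm]
  · have : (i : ℕ) ≠ j + 1 := by omega
    simp [h, this, Finsupp.single_apply, Fin.ext_iff, eq_comm]

theorem repr_rB_smul
    (hB : ∀ i : Fin (d + 1), rB F • v i = thP F b d i • v i +
      (if (i : ℕ) = 0 then 0 else
        phP F a b c d i • v ⟨(i : ℕ) - 1, lt_of_le_of_lt (Nat.sub_le _ _) i.isLt⟩))
    (i j : Fin (d + 1)) :
    v.repr (rB F • v j) i
      = (if (i : ℕ) = j then thP F b d j else 0) +
        (if (i : ℕ) + 1 = j then phP F a b c d j else 0) := by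
  rw [hB]
  have hcomm : j = i ↔ (i : ℕ) = j := by rw [Fin.ext_iff, eq_comm]
  by_cases h : (j : ℕ) = 0
  · have hij : ¬ (i : ℕ) + 1 = j := by omega
    rw [if_pos h, if_neg hij, add_zero, add_zero, map_smul, Finsupp.smul_apply,
      Module.Basis.repr_self, Finsupp.single_apply, if_congr hcomm rfl rfl, smul_eq_mul, mul_ite,
      mul_one, mul_zero]
  · have hij : (⟨(j : ℕ) - 1, lt_of_le_of_lt (Nat.sub_le _ _) j.isLt⟩ : Fin (d + 1)) = i ↔
        (i : ℕ) + 1 = j := by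
      rw [Fin.ext_iff]
      dsimp only
      omega
    simp only [if_neg h, map_add, map_smul, Finsupp.add_apply, Finsupp.smul_apply,
      Module.Basis.repr_self, Finsupp.single_apply, hcomm, hij, smul_eq_mul, mul_ite, mul_one,
      mul_zero]

variable [IsScalarTower F (RacahAlg F) V]

@[simp]
theorem opOf_apply (x : RacahAlg F) (u : V) : opOf F x V u = x • u := rfl

/-- The parameters `φᵢ` of an irreducible `R_d(a,b,c)` are nonzero. -/
theorem phP_ne_zero [CharZero F] [IsSimpleModule (RacahAlg F) V]
    (hA : ∀ i : Fin (d + 1), rA F • v i = thP F a d i • v i +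
      (if h : (i : ℕ) + 1 < d + 1 then v ⟨(i : ℕ) + 1, h⟩ else 0))
    (hB : ∀ i : Fin (d + 1), rB F • v i = thP F b d i • v i +
      (if (i : ℕ) = 0 then 0 else
        phP F a b c d i • v ⟨(i : ℕ) - 1, lt_of_le_of_lt (Nat.sub_le _ _) i.isLt⟩))
    (hδ : ∀ u : V, rDelta F • u = κ • u) {i : Fin (d + 1)} (hi : (i : ℕ) ≠ 0) :
    phP F a b c d i ≠ 0 := by
  intro h0
  set p := Submodule.span F (v '' Set.Ici i)
  have hmem : ∀ j, i ≤ j → v j ∈ p := fun j hj => Submodule.subset_span ⟨j, hj, rfl⟩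
  have hstable : ∀ x : RacahAlg F, (∀ j, i ≤ j → x • v j ∈ p) → ∀ u ∈ p, x • u ∈ p := by
    intro x hx
    have : p ≤ p.comap (opOf F x V) := by
      rw [Submodule.span_le]
      rintro _ ⟨j, hj, rfl⟩
      exact hx j hj
    exact this
  have hpA : ∀ u ∈ p, rA F • u ∈ p := hstable _ fun j hj => by
    rw [hA]
    refine p.add_mem (p.smul_mem _ (hmem j hj)) ?_
    split_ifs
    · exact hmem _ (Fin.le_def.2 (Nat.le_succ_of_le hj))
    · exact p.zero_mem
  have hpB : ∀ u ∈ p, rB F • u ∈ p := hstable _ fun j hj => by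
    rw [hB]
    refine p.add_mem (p.smul_mem _ (hmem j hj)) ?_
    split_ifs
    · exact p.zero_mem
    · rcases eq_or_lt_of_le hj with rfl | hlt
      · rw [h0, zero_smul]
        exact p.zero_mem
      · exact p.smul_mem _ (hmem _ (Fin.le_def.2 (Nat.le_sub_one_of_lt hlt)))
  have hpC : ∀ u ∈ p, rC F • u ∈ p := fun u hu => by
    rw [rC_smul hδ]
    exact p.sub_mem (p.sub_mem (p.smul_mem _ hu) (hpA u hu)) (hpB u hu)
  rcases eq_bot_or_eq_top_of_stable p hpA hpB hpC with h | h
  · exact v.ne_zero i ((Submodule.mem_bot F).1 (h ▸ hmem i le_rfl))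
  · have h0p : v 0 ∈ p := h ▸ Submodule.mem_top
    rw [v.mem_span_image] at h0p
    have h0i : i ≤ 0 := h0p (by simp)
    exact hi (Nat.le_zero.1 h0i)

theorem finrank_eigenspace_rA_le
    (hA : ∀ i : Fin (d + 1), rA F • v i = thP F a d i • v i +
      (if h : (i : ℕ) + 1 < d + 1 then v ⟨(i : ℕ) + 1, h⟩ else 0)) (μ : F) :
    Module.finrank F ((opOf F (rA F) V).eigenspace μ) ≤ 1 := by
  refine finrank_eigenspace_le_one_of_hessenberg v (fun i j hij => ?_) (fun i j hij => ?_) μ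
  · have h1 : (i : ℕ) ≠ j := by omega
    have h2 : (i : ℕ) ≠ j + 1 := by omega
    simp [repr_rA_smul hA, h1, h2]
  · simp [repr_rA_smul hA, hij]

theorem finrank_eigenspace_rB_le
    (hB : ∀ i : Fin (d + 1), rB F • v i = thP F b d i • v i +
      (if (i : ℕ) = 0 then 0 else
        phP F a b c d i • v ⟨(i : ℕ) - 1, lt_of_le_of_lt (Nat.sub_le _ _) i.isLt⟩))
    (hφ : ∀ i : Fin (d + 1), (i : ℕ) ≠ 0 → phP F a b c d i ≠ 0) (μ : F) :
    Module.finrank F ((opOf F (rB F) V).eigenspace μ) ≤ 1 := by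
  have hentry : ∀ i j, (v.reindex Fin.revPerm).repr (opOf F (rB F) V (v.reindex Fin.revPerm j)) i
      = v.repr (rB F • v j.rev) i.rev := by
    intro i j
    simp
  refine finrank_eigenspace_le_one_of_hessenberg (v.reindex Fin.revPerm)
    (fun i j hij => ?_) (fun i j hij => ?_) μ
  · have h1 : (i.rev : ℕ) ≠ j.rev := by simp only [Fin.val_rev]; omega
    have h2 : (i.rev : ℕ) + 1 ≠ j.rev := by simp only [Fin.val_rev]; omega
    rw [hentry, repr_rB_smul hB, if_neg h1, if_neg h2, add_zero]
  · have h1 : (i.rev : ℕ) ≠ j.rev := by simp only [Fin.val_rev]; omega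
    have h2 : (i.rev : ℕ) + 1 = j.rev := by simp only [Fin.val_rev]; omega
    rw [hentry, repr_rB_smul hB, if_neg h1, if_pos h2, zero_add]
    exact hφ _ (by omega)

theorem finrank_eigenspace_rC_le
    (hA : ∀ i : Fin (d + 1), rA F • v i = thP F a d i • v i +
      (if h : (i : ℕ) + 1 < d + 1 then v ⟨(i : ℕ) + 1, h⟩ else 0))
    (hB : ∀ i : Fin (d + 1), rB F • v i = thP F b d i • v i +
      (if (i : ℕ) = 0 then 0 else
        phP F a b c d i • v ⟨(i : ℕ) - 1, lt_of_le_of_lt (Nat.sub_le _ _) i.isLt⟩))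
    (hδ : ∀ u : V, rDelta F • u = κ • u) (μ : F) :
    Module.finrank F ((opOf F (rC F) V).eigenspace μ) ≤ 1 := by
  have hentry : ∀ i j : Fin (d + 1), (j : ℕ) < i → v.repr (opOf F (rC F) V (v j)) i
      = -(if (i : ℕ) = j + 1 then 1 else 0) := by
    intro i j hij
    have h1 : (i : ℕ) ≠ j := by omega
    have h2 : (i : ℕ) + 1 ≠ j := by omega
    have h3 : j ≠ i := fun h => h1 (congrArg Fin.val h.symm)
    rw [opOf_apply, rC_smul hδ, map_sub, map_sub, Finsupp.sub_apply, Finsupp.sub_apply,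
      repr_rA_smul hA, repr_rB_smul hB, if_neg h1, if_neg h1, if_neg h2]
    simp [h3]
  refine finrank_eigenspace_le_one_of_hessenberg v (fun i j hij => ?_) (fun i j hij => ?_) μ
  · have h1 : (i : ℕ) ≠ j + 1 := by omega
    rw [hentry i j (by omega), if_neg h1, neg_zero]
  · rw [hentry i j (by omega), if_pos hij]
    exact neg_ne_zero.2 one_ne_zero

/-- Two of the operators `A, B, C` that are diagonalizable with simple eigenvalues on an
irreducible module: one is irreducible tridiagonal in an eigenbasis of the other. -/
theorem exists_isDiag_isIrrTridiag_opOf [IsAlgClosed F] [CharZero F] [FiniteDimensional F V]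
    [Nontrivial V] {x y : RacahAlg F}
    (hrel : ∃ g : RacahAlg F, g * x = x * g ∧
      x * x * y - 2 * (x * y * x) + y * x * x - 2 * (x * y) - 2 * (y * x) = g)
    (hirr : ∀ p : Submodule F V, (∀ u ∈ p, x • u ∈ p) → (∀ u ∈ p, y • u ∈ p) → p = ⊥ ∨ p = ⊤)
    (hle : ∀ μ, Module.finrank F ((opOf F x V).eigenspace μ) ≤ 1)
    (htop : ⨆ μ, (opOf F x V).eigenspace μ = ⊤) :
    ∃ (n : ℕ) (b : Module.Basis (Fin n) F V),
      (LinearMap.toMatrix b b (opOf F x V)).IsDiag ∧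
      IsIrrTridiag F (LinearMap.toMatrix b b (opOf F y V)) := by
  obtain ⟨g, hg, hrel⟩ := hrel
  refine exists_isDiag_isIrrTridiag (G := opOf F g V) (LinearMap.ext fun u => ?_)
    (LinearMap.ext fun u => ?_) hirr hle htop
  · simp only [Module.End.mul_apply, opOf_apply, ← mul_smul, hg]
  · simp only [two_mul, Module.End.mul_apply, LinearMap.add_apply, LinearMap.sub_apply,
      opOf_apply, ← hrel, add_smul, sub_smul, mul_smul]

end RdModules

/-- Suppose `R_d(a,b,c)` is irreducible and `(X,Y)` is one of
`(A,B), (B,C), (C,A)`.  TFAE: (i) `X, Y` act diagonalizably; (ii) `X, Y` act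
multiplicity-freely; (iii) `X, Y` act as a Leonard pair. -/
theorem stmt10 (F : Type) [Field F] [IsAlgClosed F] [CharZero F] (d : ℕ) (a b c : F)
    (V : Type) [AddCommGroup V] [Module (RacahAlg F) V]
    (hV : IsRdModule F a b c d V) (hirr : IsSimpleModule (RacahAlg F) V)
    (X Y : RacahAlg F)
    (hXY : (X = rA F ∧ Y = rB F) ∨ (X = rB F ∧ Y = rC F) ∨ (X = rC F ∧ Y = rA F)) :
    ((ActsDiagOn F X V ∧ ActsDiagOn F Y V) ↔
      (ActsMultFreeOn F X V ∧ ActsMultFreeOn F Y V)) ∧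
    ((ActsMultFreeOn F X V ∧ ActsMultFreeOn F Y V) ↔ ActsAsLeonardPairOn F X Y V) := by
  let _ : Module F V := resF F (RacahAlg F) V
  have _ : IsScalarTower F (RacahAlg F) V := resF_tower F (RacahAlg F) V rfl
  obtain ⟨v, hA, hB, hδ⟩ := hV
  have hδ' : ∀ u : V, rDelta F • u = _ := hδ
  have : FiniteDimensional F V := v.finiteDimensional_of_finite
  have : Nontrivial V := IsSimpleModule.nontrivial (RacahAlg F) V
  have leA := finrank_eigenspace_rA_le hA
  have leB := finrank_eigenspace_rB_le hB fun i => phP_ne_zero hA hB hδ'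
  have leC := finrank_eigenspace_rC_le hA hB hδ'
  have hsum : ∀ u : V, rA F • u + rB F • u + rC F • u ∈ Submodule.span F {u} := fun u => by
    rw [← add_smul, ← add_smul]
    exact Submodule.mem_span_singleton.2 ⟨_, (hδ' u).symm⟩
  have hthird : ∀ (p : Submodule F V) (u : V), u ∈ p →
      rA F • u + rB F • u + rC F • u ∈ p := fun p u hu =>
    (Submodule.span_singleton_le_iff_mem u p).2 hu (hsum u)
  have main : ∀ x y : RacahAlg F,
      (∃ g : RacahAlg F, g * x = x * g ∧
        x * x * y - 2 * (x * y * x) + y * x * x - 2 * (x * y) - 2 * (y * x) = g) →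
      (∃ g : RacahAlg F, g * y = y * g ∧
        y * y * x - 2 * (y * x * y) + x * y * y - 2 * (y * x) - 2 * (x * y) = g) →
      (∀ p : Submodule F V, (∀ u ∈ p, x • u ∈ p) → (∀ u ∈ p, y • u ∈ p) → p = ⊥ ∨ p = ⊤) →
      (∀ μ, Module.finrank F ((opOf F x V).eigenspace μ) ≤ 1) →
      (∀ μ, Module.finrank F ((opOf F y V).eigenspace μ) ≤ 1) →
      ((ActsDiagOn F x V ∧ ActsDiagOn F y V) ↔ (ActsMultFreeOn F x V ∧ ActsMultFreeOn F y V)) ∧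
      ((ActsMultFreeOn F x V ∧ ActsMultFreeOn F y V) ↔ ActsAsLeonardPairOn F x y V) := by
    intro x y hx hy hirr lex ley
    have hdiag : (ActsDiagOn F x V ∧ ActsDiagOn F y V) ↔
        (ActsMultFreeOn F x V ∧ ActsMultFreeOn F y V) :=
      ⟨fun h => ⟨fun μ => finrank_maxGenEigenspace_eq_one lex h.1,
          fun μ => finrank_maxGenEigenspace_eq_one ley h.2⟩,
        fun h => ⟨iSup_eigenspace_eq_top_of_finrank h.1, iSup_eigenspace_eq_top_of_finrank h.2⟩⟩
    refine ⟨hdiag, fun h => ?_, fun h => hdiag.1 ?_⟩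
    · have h' := hdiag.2 h
      exact ⟨exists_isDiag_isIrrTridiag_opOf hx hirr lex h'.1,
        exists_isDiag_isIrrTridiag_opOf hy (fun p h1 h2 => hirr p h2 h1) ley h'.2⟩
    · obtain ⟨⟨_, e, he, _⟩, ⟨_, e', he', _⟩⟩ := h
      exact ⟨iSup_eigenspace_eq_top_of_isDiag e he, iSup_eigenspace_eq_top_of_isDiag e' he'⟩
  rcases hXY with ⟨rfl, rfl⟩ | ⟨rfl, rfl⟩ | ⟨rfl, rfl⟩
  · refine main _ _ (racah_pair_relation (rA_mul_rB F) (rC_mul_rA F) (rAlpha_commute F))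
      (racah_pair_relation_symm (rA_mul_rB F) (rB_mul_rC F) (rBeta_commute F))
      (fun p h1 h2 => eq_bot_or_eq_top_of_stable p h1 h2 fun u hu => ?_) leA leB
    exact (p.add_mem_iff_right (p.add_mem (h1 u hu) (h2 u hu))).1 (hthird p u hu)
  · refine main _ _ (racah_pair_relation (rB_mul_rC F) (rA_mul_rB F) (rBeta_commute F))
      (racah_pair_relation_symm (rB_mul_rC F) (rC_mul_rA F) (rGamma_commute F))
      (fun p h1 h2 => eq_bot_or_eq_top_of_stable p (fun u hu => ?_) h1 h2) leB leC
    exact (p.add_mem_iff_left (h1 u hu)).1 ((p.add_mem_iff_left (h2 u hu)).1 (hthird p u hu))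
  · refine main _ _ (racah_pair_relation (rC_mul_rA F) (rB_mul_rC F) (rGamma_commute F))
      (racah_pair_relation_symm (rC_mul_rA F) (rA_mul_rB F) (rAlpha_commute F))
      (fun p h1 h2 => eq_bot_or_eq_top_of_stable p h2 (fun u hu => ?_) h1) leC leA
    exact (p.add_mem_iff_right (h2 u hu)).1 ((p.add_mem_iff_left (h1 u hu)).1 (hthird p u hu))
end

section
/- For any scalars a, b, c ∈ F and any odd integer d ≥ 1, there exists a (d+1)-dimensional 𝔥-module E_d(a,b,c) with a basis v₀,…,v_d such that, writing σ = a+b+c−(d+1)/2 and τ = a+b−c−(d+1)/2: t₀v_i = i(d−i+1)v_{i−1} − ((d−2i+1)/2)v_i for even i with 2 ≤ i ≤ d−1, t₀v_i = ((d−2i−1)/2)v_i + v_{i+1} for odd i with 1 ≤ i ≤ d−2, t₀v₀ = −((d+1)/2)v₀, t₀v_d = −((d+1)/2)v_d; t₁v_i = i(i−d−1)v_{i−1} + a v_i + v_{i+1} for even i with 2 ≤ i ≤ d−1, t₁v_i = −a v_i for odd i with 1 ≤ i ≤ d, t₁v₀ = a v₀ + v₁; t₂v_i = b v_i for even i with 0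 ≤ i ≤ d−1, t₂v_i = −(σ+i)(τ+i)v_{i−1} − b v_i − v_{i+1} for odd i with 1 ≤ i ≤ d−2, t₂v_d = −(σ+d)(τ+d)v_{d−1} − b v_d; t₃v_i = −((σ+τ+2i+2)/2)v_i − v_{i+1} for even i with 0 ≤ i ≤ d−1, t₃v_i = (σ+i)(τ+i)v_{i−1} + ((σ+τ+2i)/2)v_i for odd i with 1 ≤ i ≤ d; and moreover t₀², t₁², t₂², t₃² act on E_d(a,b,c) as scalar multiplication by (d+1)²/4, a², b², c² respectively. -/
open FreeAlgebra

theorem resF_compHom {F A V : Type} [Field F] [Ring A] [Algebra F A] [AddCommGroup V]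
    [inst : Module F V] (f : A →ₐ[F] Module.End F V) :
    letI := Module.compHom V f.toRingHom
    inst = resF F A V := by
  refine Module.ext' _ _ fun r x => ?_
  change r • x = f (algebraMap F A r) x
  rw [f.commutes, Module.algebraMap_end_apply]

section EdModule

variable {F : Type} [Field F]

/-- The standard basis of `Fin (d + 1) → F`, extended by zero to a sequence. -/
noncomputable def edVec (F : Type) [Field F] (d n : ℕ) : Fin (d + 1) → F :=
  if h : n < d + 1 then Pi.basisFun F (Fin (d + 1)) ⟨n, h⟩ else 0

theorem edVec_coe (d : ℕ) (i : Fin (d + 1)) : edVec F d i = Pi.basisFun F (Fin (d + 1)) i :=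
  dif_pos i.isLt

theorem edVec_of_lt {d n : ℕ} (h : d < n) : edVec F d n = 0 :=
  dif_neg (by omega)

/-- The prescribed image of `edVec F d n` under `t₀, t₁, t₂, t₃` in `E_d(a,b,c)`. -/
noncomputable def edImage (a b c : F) (d : ℕ) (k : Fin 4) (n : ℕ) : Fin (d + 1) → F :=
  match k with
  | 0 => if Even n then
      ((n : F) * ((d : F) - n + 1)) • edVec F d (n - 1)
        - (((d : F) - 2 * n + 1) / 2) • edVec F d n
    else (((d : F) - 2 * n - 1) / 2) • edVec F d n + edVec F d (n + 1)
  | 1 => if Even n then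
      ((n : F) * ((n : F) - d - 1)) • edVec F d (n - 1) + a • edVec F d n + edVec F d (n + 1)
    else -a • edVec F d n
  | 2 => if Even n then b • edVec F d n
    else -((sigP F a b c d + n) * (tauP F a b c d + n)) • edVec F d (n - 1)
        - b • edVec F d n - edVec F d (n + 1)
  | 3 => if Even n then
      -((sigP F a b c d + tauP F a b c d + 2 * n + 2) / 2) • edVec F d n - edVec F d (n + 1)
    else ((sigP F a b c d + n) * (tauP F a b c d + n)) • edVec F d (n - 1)
        + ((sigP F a b c d + tauP F a b c d + 2 * n) / 2) • edVec F d n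

/-- The operators by which `t₀, t₁, t₂, t₃` act on `E_d(a,b,c)`. -/
noncomputable def edOp (a b c : F) (d : ℕ) (k : Fin 4) : Module.End F (Fin (d + 1) → F) :=
  (Pi.basisFun F (Fin (d + 1))).constr F fun i => edImage a b c d k i

theorem edOp_edVec (a b c : F) {d : ℕ} (hd : Odd d) (k : Fin 4) {n : ℕ} (hn : n ≤ d + 1) :
    edOp a b c d k (edVec F d n) = edImage a b c d k n := by
  rcases hn.eq_or_lt with rfl | hn
  · have h0 : edVec F d (d + 1) = 0 := edVec_of_lt (by omega)
    have h1 : edVec F d (d + 1 + 1) = 0 := edVec_of_lt (by omega)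
    have he : Even (d + 1) := hd.add_one
    fin_cases k <;> simp [edImage, he, h0, h1]
  · have h := (Pi.basisFun F (Fin (d + 1))).constr_basis F
      (fun i => edImage a b c d k i) ⟨n, hn⟩
    simpa only [edOp, edVec, dif_pos hn] using h

/-- The scalars by which `t₀², t₁², t₂², t₃²` act on `E_d(a,b,c)`. -/
def edSq (a b c : F) (d : ℕ) (k : Fin 4) : F :=
  match k with
  | 0 => ((d : F) + 1) ^ 2 / 4
  | 1 => a ^ 2
  | 2 => b ^ 2
  | 3 => c ^ 2

variable [CharZero F]

theorem edOp_sq (a b c : F) {d : ℕ} (hd : Odd d) (k : Fin 4) :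
    edOp a b c d k * edOp a b c d k = algebraMap F _ (edSq a b c d k) := by
  refine (Pi.basisFun F (Fin (d + 1))).ext fun i => ?_
  obtain ⟨n, hn⟩ := i
  have hw := edVec_coe (F := F) d ⟨n, hn⟩
  simp only at hw
  rw [← hw, Module.End.mul_apply, Module.algebraMap_end_apply, edOp_edVec a b c hd k hn.le]
  rcases Nat.even_or_odd n with he | ho
  · have ho1 : ¬ Even (n + 1) := Nat.not_even_iff_odd.2 he.add_one
    have h1 := edOp_edVec a b c hd k (n := n + 1) (by omega)
    have h0 := edOp_edVec a b c hd k (n := n) (by omega)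
    rcases n with _ | m
    · fin_cases k <;> simp [edImage, edSq, sigP, tauP] at h0 h1 ⊢ <;> simp [h0, h1] <;> module
    · have hm := edOp_edVec a b c hd k (n := m) (by omega)
      have hme : ¬ Even m := by simpa [Nat.even_add_one] using he
      fin_cases k <;> simp [edImage, edSq, sigP, tauP, he, ho1, hme] at h0 h1 hm ⊢ <;>
        simp [h0, h1, hm] <;> module
  · have he : ¬ Even n := Nat.not_even_iff_odd.2 ho
    have he1 : Even (n + 1) := ho.add_one
    obtain ⟨m, rfl⟩ : ∃ m, n = m + 1 := ⟨n - 1, by have := ho.pos; omega⟩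
    have h1 := edOp_edVec a b c hd k (n := m + 1 + 1) (by omega)
    have h0 := edOp_edVec a b c hd k (n := m + 1) (by omega)
    have hm := edOp_edVec a b c hd k (n := m) (by omega)
    have hme : Even m := by simpa [Nat.even_add_one] using he
    fin_cases k <;> simp [edImage, edSq, sigP, tauP, he, he1, hme] at h0 h1 hm ⊢ <;>
      simp [h0, h1, hm] <;> module

theorem edOp_sum (a b c : F) {d : ℕ} (hd : Odd d) :
    edOp a b c d 0 + edOp a b c d 1 + edOp a b c d 2 + edOp a b c d 3 = -1 := by
  refine (Pi.basisFun F (Fin (d + 1))).ext fun i => ?_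
  rw [← edVec_coe]
  simp only [LinearMap.add_apply, LinearMap.neg_apply, Module.End.one_apply,
    edOp_edVec a b c hd _ i.isLt.le, edImage, sigP, tauP]
  split_ifs <;> module

/-- The representation of `𝔥` on `E_d(a,b,c)`. -/
noncomputable def edRep (a b c : F) {d : ℕ} (hd : Odd d) :
    DAHAAlg F →ₐ[F] Module.End F (Fin (d + 1) → F) :=
  RingQuot.liftAlgHom F ⟨FreeAlgebra.lift F (edOp a b c d), by
    intro x y h
    cases h with
    | sum => simpa using edOp_sum a b c hd
    | central i j =>
      simp only [map_mul, FreeAlgebra.lift_ι_apply, edOp_sq a b c hd]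
      exact Algebra.commutes _ _⟩

theorem edRep_tGen (a b c : F) {d : ℕ} (hd : Odd d) (k : Fin 4) :
    edRep a b c hd (tGen F k) = edOp a b c d k := by
  simp [edRep, tGen]

end EdModule

/-- For any `a, b, c ∈ F` and any odd integer `d ≥ 1` there exists a
`(d+1)`-dimensional `𝔥`-module `E_d(a,b,c)` with the prescribed basis action of
`t₀, t₁, t₂, t₃`, on which `t₀², t₁², t₂², t₃²` act as scalar multiplication by
`(d+1)²/4, a², b², c²`. -/
theorem stmt12 (F : Type) [Field F] [IsAlgClosed F] [CharZero F] (a b c : F) (d : ℕ) (hd : Odd d) (hd1 : 1 ≤ d) :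
    ∃ (V : Type) (_ : AddCommGroup V) (_ : Module (DAHAAlg F) V),
      IsEdModule F a b c d V ∧ EdSquares F a b c d V := by
  have hV := resF_compHom (edRep a b c hd)
  let _ := Module.compHom (Fin (d + 1) → F) (edRep a b c hd).toRingHom
  have act (k : Fin 4) (u : Fin (d + 1) → F) : tGen F k • u = edOp a b c d k u := by
    rw [← edRep_tGen a b c hd]
    rfl
  have act_vec (k : Fin 4) (n : ℕ) (hn : n ≤ d + 1) :
      tGen F k • edVec F d n = edImage a b c d k n := by
    rw [act, edOp_edVec a b c hd k hn]
  have act_sq (k : Fin 4) :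
      actsAsScalar F (tGen F k * tGen F k) (edSq a b c d k) (Fin (d + 1) → F) := by
    rw [actsAsScalar, ← hV]
    intro u
    rw [mul_smul, act, act, ← Module.End.mul_apply, edOp_sq a b c hd,
      Module.algebraMap_end_apply]
  refine ⟨Fin (d + 1) → F, inferInstance, inferInstance, ?_, act_sq 0, act_sq 1, act_sq 2, act_sq 3⟩
  rw [IsEdModule, ← hV]
  refine ⟨Pi.basisFun F (Fin (d + 1)), edVec F d, edVec_coe d, fun n => edVec_of_lt, ?_⟩
  have hdn : ¬ Even d := Nat.not_even_iff_odd.2 hd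
  have hvd : edVec F d (d + 1) = 0 := edVec_of_lt d.lt_succ_self
  refine ⟨fun i hi _ hid => ?_, fun i hi hid => ?_, ?_, ?_, fun i hi _ hid => ?_,
    fun i hi hid => ?_, ?_, fun i hi hid => ?_, fun i hi hid => ?_, ?_, fun i hi hid => ?_,
    fun i hi hid => ?_⟩ <;>
    rw [act_vec _ _ (by omega)] <;>
    try rw [← Nat.not_even_iff_odd] at hi
  all_goals simp [edImage, *]
  module
end
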